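/- Let p be a prime and let G_m(p^b) = sum over a mod p^b of the Jacobi symbol (a/p^b) times e(am/p^b), adjusted by the factor so that τ_m(k) = ((1+i)/2 + (-1/k)(1-i)/2) G_m(k). Suppose p^a is the exact power of p dividing m (with a = ∞ if m = 0). Then for b ≥ 1: G_m(p^b) = 0 if b ≤ a is odd; G_m(p^b) = φ(p^b) if b ≤ a is even; G_m(p^b) = -p^a if b = a+1 is even; G_m(p^b) = ((m/p^a)/p) p^a √p if b = a+1 is odd; and G_m(p^b) = 0 if b ≥ a+2. -/

import Mathlib

open Finset

/-- The Gauss-type sum `τ_m(k) = Σ_{a mod k} (a/k) e(am/k)` with `(a/k)` the Jacobi symbol. -/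
noncomputable def tauSum (m : ℤ) (k : ℕ) : ℂ :=
  ∑ a ∈ Finset.range k, (jacobiSym (a : ℤ) k : ℂ) *
    Complex.exp (2 * Real.pi * Complex.I * a * m / k)

/-- `G_m(k)` defined by `τ_m(k) = ((1+i)/2 + (-1/k)(1-i)/2) G_m(k)`. -/
noncomputable def gaussG (m : ℤ) (k : ℕ) : ℂ :=
  tauSum m k / ((1 + Complex.I) / 2 + (jacobiSym (-1) k : ℂ) * (1 - Complex.I) / 2)


def qB (q : ℂ) : ℕ → ℕ → ℂ
  | _, 0 => 1
  | 0, _+1 => 0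
  | n+1, j+1 => qB q n j + q^(j+1) * qB q n (j+1)

lemma qB_zero (q : ℂ) (n : ℕ) : qB q n 0 = 1 := by cases n <;> simp [qB]

lemma qB_gt (q : ℂ) (n j : ℕ) (h : n < j) : qB q n j = 0 := by
  induction n generalizing j with
  | zero => cases j with
    | zero => omega
    | succ j => simp [qB]
  | succ n ih => cases j with
    | zero => omega
    | succ j => simp [qB, ih j (by omega), ih (j+1) (by omega)]

/-- ratio -/
lemma qB_ratio (q : ℂ) (n j : ℕ) : 
    qB q (n+j) (j+1) * (1 - q^(j+1)) = (1 - q^n) * qB q (n+j) j := by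
  induction j generalizing n with
  | zero =>
    simp only [qB_zero]
    induction n with
    | zero => simp [qB]
    | succ n ih => 
      simp only [Nat.add_zero, qB, qB_zero] at ih ⊢
      linear_combination q * ih
  | succ j ihj =>
    induction n with
    | zero => rw [qB_gt _ _ _ (by omega)]; simp
    | succ n ih =>
      have e1 := ihj (n+1)
      have h1 : n + 1 + (j+1) = (n + 1 + j) + 1 := by ring
      have h2 : n + (j+1) = n + 1 + j := by ring
      rw [h2] at ih
      rw [h1]
      simp only [qB] at ih ⊢
      linear_combination q^(j+1+1) * ih + e1

lemma qB_absorb (q : ℂ) (n j : ℕ) : 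
    qB q (n+j+1) j * (1 - q^(n+1)) = (1 - q^(n+j+1)) * qB q (n+j) j := by
  cases j with
  | zero => simp [qB_zero]
  | succ j =>
    have e := qB_ratio q (n+1) j
    have h1 : n + (j+1) = (n + 1 + j) := by ring
    rw [h1]
    simp only [qB]
    linear_combination -e

lemma qB_three (q : ℂ) (n j : ℕ) : 
    qB q (n+2) (j+1) = qB q (n+1) j + qB q (n+1) (j+1) - (1 - q^(n+1)) * qB q n j := by
  rcases le_or_gt j n with h | h
  · obtain ⟨d, rfl⟩ := Nat.exists_eq_add_of_le' h
    have e1 := qB_absorb q d j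
    have e2 := qB_ratio q (d+1) j
    have h1 : d + 1 + j = d + j + 1 := by ring
    rw [h1] at e2
    rw [show d + j + 2 = (d+j+1)+1 by ring, qB]
    linear_combination -e1 - e2
  · rw [qB_gt q n j h, qB_gt q (n+1) (j+1) (by omega), qB]
    rw [qB_gt q (n+1) (j+1) (by omega)]; simp

lemma qS_rec (q : ℂ) (n : ℕ) :
    ∑ j ∈ range (n+3), (-1)^j * qB q (n+2) j = (1 - q^(n+1)) * ∑ j ∈ range (n+1), (-1)^j * qB q n j := by
  have A : ∑ j ∈ range (n+2), (-1)^(j+1) * qB q (n+1) (j+1) + 1 = ∑ j ∈ range (n+2), (-1)^j * qB q (n+1) j := by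
    have := sum_range_succ' (fun j => (-1)^j * qB q (n+1) j) (n+2)
    rw [sum_range_succ, qB_gt q (n+1) (n+2) (by omega)] at this
    simp only [qB_zero] at this
    linear_combination -this
  rw [sum_range_succ', qB_zero]
  simp only [qB_three, mul_add, mul_sub, sum_add_distrib, sum_sub_distrib]
  have B : ∑ j ∈ range (n+2), (-1)^(j+1) * ((1 - q^(n+1)) * qB q n j) = - ((1 - q^(n+1)) * ∑ j ∈ range (n+1), (-1)^j * qB q n j) := by
    rw [sum_range_succ, qB_gt q n (n+1) (by omega), mul_sum, ← sum_neg_distrib]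
    simp only [mul_zero, add_zero]
    exact sum_congr rfl fun j _ => by ring
  have C : ∑ j ∈ range (n+2), (-1)^(j+1) * qB q (n+1) j = - ∑ j ∈ range (n+2), (-1)^j * qB q (n+1) j := by
    rw [← sum_neg_distrib]
    exact sum_congr rfl fun j _ => by ring
  linear_combination A - B + C

lemma qS_prod (q : ℂ) (h : ℕ) :
    ∑ j ∈ range (2*h+1), (-1)^j * qB q (2*h) j = ∏ i ∈ range h, (1 - q^(2*i+1)) := by
  induction h with
  | zero => simp [qB_zero]
  | succ h ih =>
    rw [prod_range_succ, ← ih]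
    exact (qS_rec q (2*h)).trans (mul_comm _ _)

/-- sums over ZMod as sums over range -/
lemma sum_zmod_range (n : ℕ) [NeZero n] (f : ZMod n → ℂ) : ∑ x, f x = ∑ j ∈ range n, f (j : ZMod n) := by
  symm
  refine Finset.sum_bij' (fun j _ => (j : ZMod n)) (fun x _ => x.val) ?_ ?_ ?_ ?_ ?_
  · simp
  · intro x _; simpa using ZMod.val_lt x
  · intro j hj; exact ZMod.val_natCast_of_lt (by simpa using hj)
  · intro x _; simp
  · intro x _; rfl

lemma qB_root (h : ℕ) [Fact (2*h+1).Prime] (j : ℕ) (hj : j ≤ 2*h) :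
    qB (ZMod.stdAddChar (-2 : ZMod (2*h+1))) (2*h) j = (-1)^j * ZMod.stdAddChar ((j:ZMod (2*h+1)) * ((j:ZMod (2*h+1))+1)) := by
  induction j with
  | zero => simp [qB_zero]
  | succ j ih =>
    have ih := ih (by omega)
    have e := qB_ratio (ZMod.stdAddChar (-2 : ZMod (2*h+1))) (2*h-j) j
    rw [Nat.sub_add_cancel (by omega), ih] at e
    have h2 : (2 : ZMod (2*h+1)) ≠ 0 := by
      intro h0
      have : ((2:ℕ) : ZMod (2*h+1)) = 0 := by exact_mod_cast h0
      rw [ZMod.natCast_eq_zero_iff] at this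
      have := Nat.le_of_dvd (by norm_num) this
      omega
    have hj1 : ((j:ZMod (2*h+1)) + 1) ≠ 0 := by
      intro h0
      have : ((j+1:ℕ) : ZMod (2*h+1)) = 0 := by exact_mod_cast h0
      rw [ZMod.natCast_eq_zero_iff] at this
      have := Nat.le_of_dvd (by omega) this
      omega
    have hp : (2 * (h : ZMod (2*h+1)) + 1) = 0 := by
      have := ZMod.natCast_self (2*h+1)
      exact_mod_cast this
    rw [← AddChar.map_nsmul_eq_pow, ← AddChar.map_nsmul_eq_pow] at e
    have a1 : (j+1) • (-2 : ZMod (2*h+1)) = -2 * (j+1) := by simp; ring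
    have a2 : (2*h-j) • (-2 : ZMod (2*h+1)) = 2 * (j+1) := by 
      rw [nsmul_eq_mul, Nat.cast_sub (by omega)]
      push_cast
      linear_combination (-2) * hp
    rw [a1, a2] at e
    have hne : 1 - ZMod.stdAddChar (-2 * ((j:ZMod (2*h+1))+1)) ≠ 0 := by
      rw [sub_ne_zero]
      intro h0
      have : (-2 * ((j:ZMod (2*h+1))+1)) = 0 := by
        apply ZMod.injective_stdAddChar
        rw [← h0, AddChar.map_zero_eq_one]
      rcases mul_eq_zero.1 this with h3 | h3
      · exact h2 (neg_eq_zero.1 h3)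
      · exact hj1 h3
    apply mul_right_cancel₀ hne
    rw [e]
    have b1 : ZMod.stdAddChar (((j+1:ℕ):ZMod (2*h+1)) * (((j+1:ℕ):ZMod (2*h+1))+1)) = ZMod.stdAddChar ((j:ZMod (2*h+1)) * ((j:ZMod (2*h+1))+1)) * ZMod.stdAddChar (2 * ((j:ZMod (2*h+1)) + 1)) := by
      rw [← AddChar.map_add_eq_mul]; congr 1; push_cast; ring
    have b2 : ZMod.stdAddChar (2 * ((j:ZMod (2*h+1)) + 1)) * ZMod.stdAddChar (-2 * ((j:ZMod (2*h+1)) + 1)) = 1 := by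
      rw [← AddChar.map_add_eq_mul, ← AddChar.map_zero_eq_one (ZMod.stdAddChar (N := 2*h+1))]; congr 1; ring
    rw [b1, pow_succ]
    linear_combination (-(-1)^j * ZMod.stdAddChar ((j:ZMod (2*h+1)) * ((j:ZMod (2*h+1))+1))) * b2

lemma sum_sq_prod (h : ℕ) [Fact (2*h+1).Prime] :
    ∑ x : ZMod (2*h+1), ZMod.stdAddChar (x^2) = 
      ∏ i ∈ range h, (Complex.I * (2 * Real.sin (2 * Real.pi * (2*i+1) / (2*h+1)) : ℝ)) := by
  have e := qS_prod (ZMod.stdAddChar (-2 : ZMod (2*h+1))) h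
  have hp : (2 * (h : ZMod (2*h+1)) + 1) = 0 := by
    have := ZMod.natCast_self (2*h+1)
    exact_mod_cast this
  have e1 : ∑ j ∈ range (2*h+1), (-1)^j * qB (ZMod.stdAddChar (-2 : ZMod (2*h+1))) (2*h) j 
      = ∑ x : ZMod (2*h+1), ZMod.stdAddChar (x * (x+1)) := by
    rw [sum_zmod_range]
    refine sum_congr rfl fun j hj => ?_
    rw [qB_root h j (by simp at hj; omega), ← mul_assoc, ← mul_pow]; simp
  have e2 : ∑ x : ZMod (2*h+1), ZMod.stdAddChar (x^2) = 
      ZMod.stdAddChar (((h : ZMod (2*h+1))+1)^2) * ∑ x : ZMod (2*h+1), ZMod.stdAddChar (x * (x+1)) := by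
    rw [← Equiv.sum_comp (Equiv.addRight ((h : ZMod (2*h+1))+1)), mul_sum]
    refine sum_congr rfl fun x _ => ?_
    rw [← AddChar.map_add_eq_mul]
    congr 1
    simp only [Equiv.coe_addRight]
    linear_combination x * hp
  have e3 : ∀ n : ℕ, ∏ i ∈ range n, (1 - ZMod.stdAddChar (-2 : ZMod (2*h+1)) ^ (2*i+1)) = 
      ZMod.stdAddChar (-(n : ZMod (2*h+1))^2) * ∏ i ∈ range n, (Complex.I * (2 * Real.sin (2 * Real.pi * (2*i+1) / (2*h+1)) : ℝ)) := by
    intro n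
    induction n with
    | zero => simp
    | succ n ih =>
      rw [prod_range_succ, prod_range_succ, ih]
      have c1 : Complex.I * (2 * Real.sin (2 * Real.pi * (2*n+1) / (2*h+1)) : ℝ) = 
        ZMod.stdAddChar ((2*n+1 : ℤ) : ZMod (2*h+1)) - ZMod.stdAddChar ((-(2*n+1) : ℤ) : ZMod (2*h+1)) := by
        rw [ZMod.stdAddChar_coe, ZMod.stdAddChar_coe]
        push_cast
        rw [Complex.sin]
        have : Complex.I * Complex.I = -1 := Complex.I_mul_I
        rw [show -(2 * (Real.pi:ℂ) * (2*n+1) / (2*h+1)) * Complex.I = 2 * Real.pi * Complex.I * (-(2*n+1)) / (2*h+1) by ring,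
         show (2 * (Real.pi:ℂ) * (2*n+1) / (2*h+1)) * Complex.I = 2 * Real.pi * Complex.I * ((2*n+1)) / (2*h+1) by ring]
        linear_combination (Complex.exp (2 * Real.pi * Complex.I * (-(2*n+1)) / (2*h+1)) - Complex.exp (2 * Real.pi * Complex.I * ((2*n+1)) / (2*h+1))) * this
      rw [c1, ← AddChar.map_nsmul_eq_pow]
      have d1 : ZMod.stdAddChar (-((n+1:ℕ) : ZMod (2*h+1))^2) = ZMod.stdAddChar (-(n : ZMod (2*h+1))^2) * ZMod.stdAddChar ((-(2*n+1) : ℤ) : ZMod (2*h+1)) := by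
        rw [← AddChar.map_add_eq_mul]; congr 1; push_cast; ring
      have d2 : ZMod.stdAddChar ((2*n+1) • (-2 : ZMod (2*h+1))) = ZMod.stdAddChar ((-(2*n+1) : ℤ) : ZMod (2*h+1)) * ZMod.stdAddChar ((-(2*n+1) : ℤ) : ZMod (2*h+1)) := by
        rw [← AddChar.map_add_eq_mul]; congr 1; rw [nsmul_eq_mul]; push_cast; ring
      have d3 : ZMod.stdAddChar ((-(2*n+1) : ℤ) : ZMod (2*h+1)) * ZMod.stdAddChar ((2*n+1 : ℤ) : ZMod (2*h+1)) = 1 := by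
        rw [← AddChar.map_add_eq_mul, ← AddChar.map_zero_eq_one (ZMod.stdAddChar (N := 2*h+1))]; congr 1; push_cast; ring
      rw [d1, d2]
      generalize ∏ i ∈ range n, (Complex.I * (2 * Real.sin (2 * Real.pi * (2*i+1) / (2*h+1)) : ℝ)) = Q
      linear_combination (-ZMod.stdAddChar (-(n : ZMod (2*h+1))^2) * Q) * d3
  rw [e2, ← e1, e, e3, ← mul_assoc, ← AddChar.map_add_eq_mul]
  rw [show ((h : ZMod (2*h+1)) + 1)^2 + -(h:ZMod (2*h+1))^2 = 0 by linear_combination hp]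
  simp

noncomputable def chiC (p : ℕ) [Fact p.Prime] : MulChar (ZMod p) ℂ :=
  (quadraticChar (ZMod p)).ringHomComp (Int.castRingHom ℂ)

lemma gauss_eq_sum_sq (p : ℕ) [Fact p.Prime] (hp : p ≠ 2) :
    gaussSum (chiC p) ZMod.stdAddChar = ∑ x : ZMod p, ZMod.stdAddChar (x^2) := by
  have h0 : ∑ x : ZMod p, ZMod.stdAddChar x = (0:ℂ) := by
    apply AddChar.sum_eq_zero_of_ne_one
    intro h
    have : (1 : ZMod p) = 0 := by
      apply ZMod.injective_stdAddChar
      rw [h]; simp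
    exact one_ne_zero this
  rw [← Finset.sum_fiberwise (s := univ) (g := fun x : ZMod p => x^2), gaussSum, ← add_zero (∑ a, _), ← h0, ← sum_add_distrib]
  refine sum_congr rfl fun a _ => ?_
  have h1 : ∑ x ∈ univ.filter (fun x : ZMod p => x^2 = a), ZMod.stdAddChar (x^2) = ∑ x ∈ univ.filter (fun x : ZMod p => x^2 = a), (ZMod.stdAddChar a : ℂ) :=
    sum_congr rfl fun x hx => by rw [(mem_filter.1 hx).2]
  rw [h1, sum_const, nsmul_eq_mul]
  have h2 := quadraticChar_card_sqrts (F := ZMod p) (by rwa [ZMod.ringChar_zmod_n]) a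
  have h3 : (univ.filter (fun x : ZMod p => x^2 = a)) = {x : ZMod p | x ^ 2 = a}.toFinset := by
    ext; simp
  rw [h3]
  have h4 := congrArg (Int.cast : ℤ → ℂ) h2
  push_cast at h4
  rw [h4]
  simp [chiC, MulChar.ringHomComp_apply]
  ring

lemma chiC_ne_one (p : ℕ) [Fact p.Prime] (hp : p ≠ 2) : chiC p ≠ 1 := by
  unfold chiC
  rw [MulChar.ringHomComp_ne_one_iff (RingHom.injective_int _)]
  exact quadraticChar_ne_one (by rwa [ZMod.ringChar_zmod_n])

lemma chiC_quad (p : ℕ) [Fact p.Prime] : (chiC p).IsQuadratic :=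
  (quadraticChar_isQuadratic _).comp _

lemma chiC_int (p : ℕ) [Fact p.Prime] (a : ℤ) : chiC p a = (jacobiSym a p : ℂ) := by
  rw [← jacobiSym.legendreSym.to_jacobiSym]
  simp [chiC, legendreSym, MulChar.ringHomComp_apply]

lemma sin_prod_pos (h k : ℕ) (hk : h = 2*k ∨ h = 2*k+1) :
    0 < (-1)^k * ∏ i ∈ range h, (2 * Real.sin (2 * Real.pi * (2*i+1) / (2*h+1))) := by
  obtain ⟨l, hl⟩ : ∃ l, h = l + k := ⟨h - k, by omega⟩
  have hpos : (0:ℝ) < 2*h+1 := by positivity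
  have key : (-1)^k * ∏ i ∈ range h, (2 * Real.sin (2 * Real.pi * (2*i+1) / (2*h+1))) =
     (∏ i ∈ range l, (2 * Real.sin (2 * Real.pi * (2*i+1) / (2*h+1)))) *
     ∏ i ∈ range k, (-(2 * Real.sin (2 * Real.pi * (2*((l+i:ℕ):ℝ)+1) / (2*h+1)))) := by
    rw [prod_neg, card_range]
    generalize (2*(h:ℝ)+1) = H
    rw [hl, prod_range_add]; ring
  rw [key]
  apply mul_pos
  · apply prod_pos
    intro i hi
    have hi : 2*(2*i+1) < 2*h+1 := by simp at hi; omega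
    have hi : 2*(2*(i:ℝ)+1) < 2*h+1 := by exact_mod_cast hi
    apply mul_pos two_pos
    apply Real.sin_pos_of_pos_of_lt_pi
    · positivity
    · rw [div_lt_iff₀ hpos]; nlinarith [Real.pi_pos]
  · apply prod_pos
    intro i hi
    have hi1 : 2*h+1 < 2*(2*(l+i)+1) := by simp at hi; omega
    have hi2 : (2*(l+i)+1) < 2*h+1 := by simp at hi; omega
    have hi1 : 2*(h:ℝ)+1 < 2*(2*((l+i:ℕ):ℝ)+1) := by exact_mod_cast hi1
    have hi2 : (2*((l+i:ℕ):ℝ)+1) < 2*h+1 := by exact_mod_cast hi2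
    have : Real.sin (2 * Real.pi * (2*((l+i:ℕ):ℝ)+1) / (2*h+1)) < 0 := by
      rw [← Real.sin_sub_two_pi]
      apply Real.sin_neg_of_neg_of_neg_pi_lt
      · rw [sub_neg, div_lt_iff₀ hpos]; nlinarith [Real.pi_pos]
      · rw [lt_sub_iff_add_lt, lt_div_iff₀ hpos]; nlinarith [Real.pi_pos]
    linarith

lemma gauss_sign (p : ℕ) [Fact p.Prime] (hp : Odd p) :
    gaussSum (chiC p) ZMod.stdAddChar = 
      ((1 + Complex.I) / 2 + (jacobiSym (-1) p : ℂ) * (1 - Complex.I) / 2) * Real.sqrt p := by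
  obtain ⟨h, rfl⟩ := hp
  have hh : 2*h+1 ≠ 2 := by omega
  have e := gauss_eq_sum_sq (2*h+1) hh
  rw [sum_sq_prod, prod_mul_distrib, prod_const, card_range, ← Complex.ofReal_prod] at e
  have sq := gaussSum_sq (χ := chiC (2*h+1)) (chiC_ne_one _ hh) (chiC_quad (2*h+1)) (ZMod.isPrimitive_stdAddChar (2*h+1))
  have hm := chiC_int (2*h+1) (-1)
  have hJ := jacobiSym.at_neg_one (b := 2*h+1) ⟨h, rfl⟩
  push_cast at hm
  rw [hm, e, ZMod.card, mul_pow] at sq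
  rw [e]
  obtain ⟨k, hk⟩ : ∃ k, h = 2*k ∨ h = 2*k+1 := ⟨h/2, by omega⟩
  have pos := sin_prod_pos h k hk
  set R := ∏ i ∈ range h, (2 * Real.sin (2 * Real.pi * (2*i+1) / (2*h+1))) with hR
  have I2 : Complex.I^2 = -1 := Complex.I_sq
  have k2 : ((-1:ℝ)^k)^2 = 1 := by rw [← pow_mul, mul_comm, pow_mul]; simp
  have k2' : ((-1:ℂ)^k)^2 = 1 := by exact_mod_cast congrArg (Complex.ofReal) k2
  have R2 : R^2 = ((2*h+1:ℕ):ℝ) → Real.sqrt ((2*h+1:ℕ):ℝ) = (-1)^k * R := by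
    intro h1
    rw [← h1, Real.sqrt_eq_iff_mul_self_eq (sq_nonneg _) pos.le]
    linear_combination (-R^2) * k2
  rcases hk with hk | hk
  · have hJ1 : jacobiSym (-1) (2*h+1) = 1 := by
      rw [hJ]; exact ZMod.χ₄_nat_one_mod_four (by omega)
    have hI : Complex.I^h = (-1)^k := by rw [hk, pow_mul, I2]
    rw [hJ1, hI, k2'] at sq
    rw [R2 (by apply Complex.ofReal_injective; push_cast at sq ⊢; linear_combination sq), hJ1, hI]
    push_cast
    ring
  · have hJ1 : jacobiSym (-1) (2*h+1) = -1 := by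
      rw [hJ]; exact ZMod.χ₄_nat_three_mod_four (by omega)
    have hI : Complex.I^h = (-1)^k * Complex.I := by rw [hk, pow_succ, pow_mul, I2]
    rw [hJ1, hI, mul_pow, k2', I2] at sq
    rw [R2 (by apply Complex.ofReal_injective; push_cast at sq ⊢; linear_combination -sq), hJ1, hI]
    push_cast
    ring

lemma sum_range_block (f : ℕ → ℂ) (p n : ℕ) :
    ∑ a ∈ range (n*p), f a = ∑ s ∈ range n, ∑ r ∈ range p, f (s*p+r) := by
  induction n with
  | zero => simp
  | succ n ih => rw [add_mul, one_mul, sum_range_add, ih, sum_range_succ]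

lemma exp_std (n : ℕ) [NeZero n] (m : ℤ) (s : ℕ) :
    Complex.exp (2 * Real.pi * Complex.I * s * m / n) = ZMod.stdAddChar ((s : ZMod n) * (m : ZMod n)) := by
  have := ZMod.stdAddChar_coe (N := n) ((s:ℤ) * m)
  push_cast at this
  rw [this]
  congr 1; ring

lemma inner_exp_sum (n : ℕ) [NeZero n] (m : ℤ) :
    ∑ s ∈ range n, Complex.exp (2 * Real.pi * Complex.I * s * m / n) = if (n:ℤ) ∣ m then (n:ℂ) else 0 := by
  have := AddChar.sum_mulShift (m : ZMod n) (ZMod.isPrimitive_stdAddChar n)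
  rw [sum_zmod_range] at this
  rw [sum_congr rfl fun s _ => exp_std n m s, this]
  simp [ZMod.intCast_zmod_eq_zero_iff_dvd]

lemma tau_split (p : ℕ) [Fact p.Prime] (c : ℕ) (m : ℤ) :
    tauSum m (p^(c+1)) = (if ((p^c : ℕ) : ℤ) ∣ m then ((p^c:ℕ):ℂ) else 0) *
      ∑ r ∈ range p, (jacobiSym r p : ℂ)^(c+1) * Complex.exp (2 * Real.pi * Complex.I * r * m / (p^(c+1) : ℕ)) := by
  have hp0 : (p:ℂ) ≠ 0 := by exact_mod_cast (Fact.out : p.Prime).ne_zero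
  rw [tauSum, ← inner_exp_sum]
  conv_lhs => rw [pow_succ p c]
  rw [sum_range_block, sum_mul_sum]
  refine sum_congr rfl fun s _ => sum_congr rfl fun r _ => ?_
  rw [← pow_succ, jacobiSym.pow_right]
  have h1 : jacobiSym ((s*p+r:ℕ):ℤ) p = jacobiSym r p := by
    apply jacobiSym.mod_left'
    push_cast
    simp
  rw [h1, mul_left_comm, ← Complex.exp_add]
  push_cast
  congr 2
  field_simp
  ring

lemma tau_dvd (p : ℕ) [Fact p.Prime] (c : ℕ) (m : ℤ) :
    tauSum ((p:ℤ)^c * m) (p^(c+1)) = (p:ℂ)^c *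
      ∑ x : ZMod p, (chiC p x)^(c+1) * ZMod.stdAddChar (x * (m : ZMod p)) := by
  have hp0 : (p:ℂ) ≠ 0 := by exact_mod_cast (Fact.out : p.Prime).ne_zero
  rw [tau_split, if_pos (by push_cast; exact dvd_mul_right _ _), sum_zmod_range]
  push_cast
  congr 1
  refine sum_congr rfl fun r _ => ?_
  have := chiC_int p r
  push_cast at this
  rw [this, ← exp_std]
  congr 2
  field_simp
  ring

lemma chiC_even (p : ℕ) [Fact p.Prime] (b : ℕ) (hb : 1 ≤ b) (hb2 : Even b) (x : ZMod p) :
    (chiC p x)^b = 1 - if x = 0 then 1 else 0 := by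
  split_ifs with h
  · subst h; rw [MulChar.map_zero, zero_pow (by omega), sub_self]
  · have h1 : (chiC p x)^2 = 1 := by
      rw [← MulChar.pow_apply' _ two_ne_zero, (chiC_quad p).sq_eq_one, MulChar.one_apply (isUnit_iff_ne_zero.2 h)]
    obtain ⟨k, rfl⟩ := hb2
    rw [← two_mul, pow_mul, h1]; simp

lemma chiC_odd (p : ℕ) [Fact p.Prime] (b : ℕ) (hb2 : Odd b) (x : ZMod p) :
    (chiC p x)^b = chiC p x := by
  rw [← MulChar.pow_apply' _ hb2.pos.ne', (chiC_quad p).pow_odd hb2]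

lemma final_even (p : ℕ) [Fact p.Prime] (b : ℕ) (hb : 1 ≤ b) (hb2 : Even b) (m : ZMod p) :
    ∑ x : ZMod p, (chiC p x)^b * ZMod.stdAddChar (x * m) = (if m = 0 then (p:ℂ) else 0) - 1 := by
  have := AddChar.sum_mulShift m (ZMod.isPrimitive_stdAddChar p)
  simp only [chiC_even p b hb hb2, sub_mul, one_mul, sum_sub_distrib, this]
  simp [ZMod.card]

lemma final_odd (p : ℕ) [Fact p.Prime] (b : ℕ) (hb2 : Odd b) (hp : Odd p) (m : ZMod p) :
    ∑ x : ZMod p, (chiC p x)^b * ZMod.stdAddChar (x * m) = chiC p m * gaussSum (chiC p) ZMod.stdAddChar := by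
  simp only [chiC_odd p b hb2]
  by_cases h : m = 0
  · subst h
    simp only [mul_zero, AddChar.map_zero_eq_one, mul_one, MulChar.map_zero, zero_mul]
    exact MulChar.sum_eq_zero_of_ne_one (chiC_ne_one p (by rintro rfl; exact absurd hp (by decide)))
  · have := gaussSum_mulShift_eq (chiC p) ZMod.stdAddChar (Units.mk0 m h)
    rw [(chiC_quad p).inv] at this
    simp only [Units.val_mk0] at this
    rw [← this, gaussSum]
    exact sum_congr rfl fun x _ => by rw [AddChar.mulShift_apply, mul_comm m x]

lemma den_ne (p : ℕ) (hp : Odd p) :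
    ((1 + Complex.I) / 2 + (jacobiSym (-1) p : ℂ) * (1 - Complex.I) / 2) ≠ 0 := by
  have : p % 4 = 1 ∨ p % 4 = 3 := by rcases hp with ⟨k, rfl⟩; omega
  rw [jacobiSym.at_neg_one hp]
  rcases this with h | h
  · rw [ZMod.χ₄_nat_one_mod_four h]
    intro h; apply one_ne_zero (α := ℂ); push_cast at h; linear_combination h
  · rw [ZMod.χ₄_nat_three_mod_four h]
    intro h; apply Complex.I_ne_zero; push_cast at h; linear_combination h

lemma jac_sq (p : ℕ) (hp : Odd p) : (jacobiSym (-1) p)^2 = 1 :=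
  jacobiSym.sq_one (by simp)

lemma G_even (p : ℕ) [Fact p.Prime] (hp : Odd p) (c : ℕ) (hc : Even (c+1)) (m : ℤ) :
    gaussG ((p:ℤ)^c * m) (p^(c+1)) = (p:ℂ)^c * ((if (p:ℤ) ∣ m then (p:ℂ) else 0) - 1) := by
  rw [gaussG, tau_dvd, final_even p (c+1) (by omega) hc, jacobiSym.pow_right]
  have : (jacobiSym (-1) p)^(c+1) = 1 := by
    obtain ⟨k, hk⟩ := hc
    rw [hk, ← two_mul, pow_mul, jac_sq p hp, one_pow]
  rw [this]
  simp only [ZMod.intCast_zmod_eq_zero_iff_dvd]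
  rw [show ((1 + Complex.I) / 2 + ((1:ℤ) : ℂ) * (1 - Complex.I) / 2) = 1 by push_cast; ring, div_one]

lemma G_odd (p : ℕ) [Fact p.Prime] (hp : Odd p) (c : ℕ) (hc : Odd (c+1)) (m : ℤ) :
    gaussG ((p:ℤ)^c * m) (p^(c+1)) = (jacobiSym m p : ℂ) * (p:ℂ)^c * Real.sqrt p := by
  rw [gaussG, tau_dvd, final_odd p (c+1) hc hp, jacobiSym.pow_right, gauss_sign p hp, chiC_int]
  have : (jacobiSym (-1) p)^(c+1) = jacobiSym (-1) p := by
    obtain ⟨k, hk⟩ := hc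
    rw [hk, pow_succ, pow_mul, jac_sq p hp, one_pow, one_mul]
  rw [this, div_eq_iff (den_ne p hp)]
  ring

lemma G_zero (p : ℕ) [Fact p.Prime] (c : ℕ) (m : ℤ) (h : ¬ (p:ℤ)^c ∣ m) :
    gaussG m (p^(c+1)) = 0 := by
  rw [gaussG, tau_split, if_neg (by push_cast; exact h)]; simp

lemma G_small (p : ℕ) [Fact p.Prime] (hp : Odd p) (b : ℕ) (hb : 1 ≤ b) (m : ℤ) (h : (p:ℤ)^b ∣ m) :
    (Odd b → gaussG m (p ^ b) = 0) ∧
      (Even b → gaussG m (p ^ b) = (Nat.totient (p ^ b) : ℂ)) := by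
  obtain ⟨c, rfl⟩ := Nat.exists_eq_add_of_le' hb
  obtain ⟨k, rfl⟩ := h
  have hP : p.Prime := Fact.out
  rw [pow_succ, mul_assoc]
  refine ⟨fun ho => ?_, fun he => ?_⟩
  · rw [G_odd p hp c ho]
    have : jacobiSym ((p:ℤ) * k) p = 0 := by
      rw [jacobiSym.eq_zero_iff_not_coprime]
      simp [hP.ne_one]
    rw [this]; simp
  · rw [G_even p hp c he, if_pos (dvd_mul_right _ _), Nat.totient_prime_pow_succ hP]
    push_cast [hP.one_le]
    rfl

theorem stmt0 (p : ℕ) (hp : p.Prime) (hpodd : Odd p) (b : ℕ) (hb : 1 ≤ b) (m : ℤ) :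
    (m = 0 →
      (Odd b → gaussG m (p ^ b) = 0) ∧
      (Even b → gaussG m (p ^ b) = (Nat.totient (p ^ b) : ℂ))) ∧
    (∀ a : ℕ, m ≠ 0 → (p : ℤ) ^ a ∣ m → ¬ (p : ℤ) ^ (a + 1) ∣ m →
      ((Odd b → b ≤ a → gaussG m (p ^ b) = 0) ∧
       (Even b → b ≤ a → gaussG m (p ^ b) = (Nat.totient (p ^ b) : ℂ)) ∧
       (Even b → b = a + 1 → gaussG m (p ^ b) = -(p : ℂ) ^ a) ∧
       (Odd b → b = a + 1 →
         gaussG m (p ^ b) = (jacobiSym (m / (p : ℤ) ^ a) p : ℂ) * (p : ℂ) ^ a * Real.sqrt p) ∧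
       (a + 2 ≤ b → gaussG m (p ^ b) = 0))) := by
  haveI : Fact p.Prime := ⟨hp⟩
  refine ⟨fun h => G_small p hpodd b hb m (by simp [h]), fun a _ hd hnd => ⟨?_, ?_, ?_, ?_, ?_⟩⟩
  · exact fun ho hba => (G_small p hpodd b hb m ((pow_dvd_pow _ hba).trans hd)).1 ho
  · exact fun ho hba => (G_small p hpodd b hb m ((pow_dvd_pow _ hba).trans hd)).2 ho
  · rintro he rfl
    obtain ⟨k, rfl⟩ := hd
    rw [G_even p hpodd a he, if_neg]
    · ring
    · intro hk
      exact hnd (by rw [pow_succ]; exact mul_dvd_mul_left _ hk)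
  · rintro ho rfl
    obtain ⟨k, rfl⟩ := hd
    rw [G_odd p hpodd a ho, Int.mul_ediv_cancel_left]
    exact pow_ne_zero _ (by exact_mod_cast hp.ne_zero)
  · intro hab
    obtain ⟨c, rfl⟩ := Nat.exists_eq_add_of_le' hb
    exact G_zero p c m fun h => hnd ((pow_dvd_pow _ (by omega)).trans h)
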